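/- Let c = (c₁,…,cₙ) ∈ 𝒜⁺ with n ≥ 3, and let i, j, ℓ ∈ {1,…,n} be pairwise distinct with φ_j(ℓ) = 1 (i.e., the vertices j and ℓ are joined by an edge of the triangulation associated to c). Then gcd(φ_i(j), φ_i(ℓ)) = 1. In particular, if φ_i(j) = φ_i(ℓ) then φ_i(j) = φ_i(ℓ) = 1. -/

import Mathlib

open Matrix Finset

/-- The matrix `η(a)` with rows `(a, -1)` and `(1, 0)`. -/
def etaM (a : ℤ) : Matrix (Fin 2) (Fin 2) ℤ := !![a, -1; 1, 0]

/-- The set `𝒜⁺` of η-sequences, as an inductive predicate on lists of integers. -/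
inductive IsEta : List ℤ → Prop
  | base : IsEta [0, 0]
  | rotate {c : List ℤ} : IsEta c → IsEta (c.rotate 1)
  | reverse {c : List ℤ} : IsEta c → IsEta c.reverse
  | expand {a b : ℤ} {t : List ℤ} : IsEta (a :: b :: t) → IsEta ((a + 1) :: 1 :: (b + 1) :: t)

/-- The `i`-th entry (1-indexed) of a sequence. -/
def entryOf (c : List ℤ) (i : ℕ) : ℤ := c.getD (i - 1) 0

/-- `φ_i(j)`: `0` if `i = j`; the (2,1)-entry of `η(c_i)⋯η(c_{j-1})` if `i < j`;
the (2,1)-entry of `η(c_j)⋯η(c_{i-1})` if `j < i`.  (Indices are 1-based.) -/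
def phi (c : List ℤ) (i j : ℕ) : ℤ :=
  if i = j then 0
  else if i < j then (((c.drop (i - 1)).take (j - i)).map etaM).prod 1 0
  else (((c.drop (j - 1)).take (i - j)).map etaM).prod 1 0

open Classical in
/-- `m_i`: the set of positions `j ∈ {1,…,n}` where `φ_i` attains its maximum. -/
noncomputable def mset (c : List ℤ) (i : ℕ) : Finset ℕ :=
  (Finset.Icc 1 c.length).filter (fun j => ∀ l ∈ Finset.Icc 1 c.length, phi c i l ≤ phi c i j)

/-- `i ⊕ k`: addition of 1-based indices, wrapping around modulo `n` (for `i + k ≤ 2n`). -/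
def addIdx (n i k : ℕ) : ℕ := if i + k ≤ n then i + k else i + k - n

/-- `c` is dense if for every `i ∈ {1,…,n}`, `|m_i| > 1` or `|m_{i+1}| > 1`
(indices taken cyclically). -/
def DenseSeq (c : List ℤ) : Prop :=
  ∀ i ∈ Finset.Icc 1 c.length,
    1 < (mset c i).card ∨ 1 < (mset c (addIdx c.length i 1)).card

/-- `c` is fan-shaped if a cyclic rotation of `c` equals `(n-2, 1, 2, …, 2, 1)`. -/
def IsFan (c : List ℤ) : Prop :=
  ∃ k, c.rotate k =
    ((c.length : ℤ) - 2) :: 1 :: (List.replicate (c.length - 3) (2 : ℤ) ++ [1])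

/-- The product `η(c₁)⋯η(cₙ)`. -/
def etaProd (c : List ℤ) : Matrix (Fin 2) (Fin 2) ℤ := (c.map etaM).prod

@[simp] lemma etaProd_nil : etaProd [] = 1 := rfl

lemma etaProd_cons (a : ℤ) (c : List ℤ) : etaProd (a :: c) = etaM a * etaProd c := by
  simp [etaProd]

lemma etaProd_append (c d : List ℤ) : etaProd (c ++ d) = etaProd c * etaProd d := by
  simp [etaProd]

lemma etaProd_cons_zero_zero (a : ℤ) (c : List ℤ) :
    etaProd (a :: c) 0 0 = a * etaProd c 0 0 - etaProd c 1 0 := by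
  simp [etaProd_cons, etaM, Matrix.mul_apply, Fin.sum_univ_two]
  ring

lemma etaProd_cons_zero_one (a : ℤ) (c : List ℤ) :
    etaProd (a :: c) 0 1 = a * etaProd c 0 1 - etaProd c 1 1 := by
  simp [etaProd_cons, etaM, Matrix.mul_apply, Fin.sum_univ_two]
  ring

lemma etaProd_cons_one (a : ℤ) (c : List ℤ) (k : Fin 2) :
    etaProd (a :: c) 1 k = etaProd c 0 k := by
  simp [etaProd_cons, etaM, Matrix.mul_apply, Fin.sum_univ_two]

lemma etaProd_concat_zero (c : List ℤ) (a : ℤ) (k : Fin 2) :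
    etaProd (c ++ [a]) k 0 = a * etaProd c k 0 + etaProd c k 1 := by
  simp [etaProd_append, etaProd_cons, etaM, Matrix.mul_apply, Fin.sum_univ_two]
  ring

lemma etaProd_concat_one (c : List ℤ) (a : ℤ) (k : Fin 2) :
    etaProd (c ++ [a]) k 1 = -etaProd c k 0 := by
  simp [etaProd_append, etaProd_cons, etaM, Matrix.mul_apply, Fin.sum_univ_two]

lemma det_etaProd (c : List ℤ) : (etaProd c).det = 1 := by
  induction c with
  | nil => simp
  | cons a c ih => rw [etaProd_cons, Matrix.det_mul, ih]; simp [etaM, Matrix.det_fin_two]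

lemma etaProd_reverse (c : List ℤ) :
    etaProd c.reverse =
      !![etaProd c 0 0, -etaProd c 1 0; -etaProd c 0 1, etaProd c 1 1] := by
  induction c with
  | nil => ext i j; fin_cases i <;> fin_cases j <;> simp
  | cons a c ih =>
    rw [List.reverse_cons]
    ext i j
    fin_cases i <;> fin_cases j <;>
      simp [etaProd_concat_zero, etaProd_concat_one, etaProd_cons_zero_zero,
        etaProd_cons_zero_one, etaProd_cons_one, ih] <;> ring

/-- Every continuant of a block of consecutive entries that avoids both ends is nonnegative. -/
def InteriorNonneg (c : List ℤ) : Prop :=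
  ∀ p w s : List ℤ, p ≠ [] → s ≠ [] → c = p ++ w ++ s → 0 ≤ etaProd w 0 0

lemma IsEta.etaProd_eq {c : List ℤ} (h : IsEta c) : etaProd c = -1 := by
  induction h with
  | base =>
    ext i j
    fin_cases i <;> fin_cases j <;> simp [etaProd, etaM]
  | @rotate c _ ih =>
    cases c with
    | nil => simpa using ih
    | cons a t =>
      rw [List.rotate_cons_succ, List.rotate_zero, etaProd_append, etaProd_cons a [],
        etaProd_nil, mul_one]
      have h : etaM a * -etaProd t = 1 := by rw [mul_neg, ← etaProd_cons, ih, neg_neg]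
      have h' := mul_eq_one_comm.mp h
      rw [neg_mul] at h'
      rw [← h', neg_neg]
  | @reverse c _ ih =>
    rw [etaProd_reverse, ih]
    ext i j
    fin_cases i <;> fin_cases j <;> simp
  | @expand a b t _ ih =>
    rw [← ih]
    simp only [etaProd_cons, ← mul_assoc]
    congr 1
    ext i j
    fin_cases i <;> fin_cases j <;> simp [etaM]; ring

lemma InteriorNonneg.rotate {c : List ℤ} (hc : InteriorNonneg c) (hprod : etaProd c = -1) :
    InteriorNonneg (c.rotate 1) := by
  intro p w s hp hs hpws
  cases c with
  | nil => simp at hpws; simp_all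
  | cons a t =>
    rw [List.rotate_cons_succ, List.rotate_zero] at hpws
    obtain ⟨s', b, rfl⟩ := List.eq_nil_or_concat s |>.resolve_left hs
    rw [List.concat_eq_append, ← List.append_assoc] at hpws
    obtain ⟨ht, hab⟩ := List.append_inj' hpws rfl
    by_cases hs' : s' = []
    · obtain ⟨p', q, rfl⟩ := List.eq_nil_or_concat p |>.resolve_left hp
      rw [List.concat_eq_append] at ht
      subst hs'
      rw [List.append_nil] at ht
      have hdet := det_etaProd (a :: (p' ++ [q]))
      have hnn := hc [a] p' (q :: w) (by simp) (by simp) (by simp [ht])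
      rw [ht, ← List.cons_append, etaProd_append] at hprod
      have h00 := congrFun (congrFun hprod 0) 0
      have h10 := congrFun (congrFun hprod 1) 0
      have h11 : etaProd (a :: (p' ++ [q])) 1 1 = -etaProd p' 0 0 := by
        rw [etaProd_cons_one, etaProd_concat_one]
      rw [Matrix.det_fin_two] at hdet
      simp only [Matrix.mul_apply, Fin.sum_univ_two, Matrix.neg_apply, Matrix.one_apply_eq,
        Matrix.one_apply_ne (one_ne_zero : (1 : Fin 2) ≠ 0)] at h00 h10
      have key : etaProd w 0 0 = etaProd p' 0 0 := by
        linear_combination (etaProd (a :: (p' ++ [q])) 1 1) * h00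
          - (etaProd (a :: (p' ++ [q])) 0 1) * h10 - etaProd w 0 0 * hdet - h11
      rwa [key]
    · exact hc (a :: p) w s' (by simp) hs' (by simp [ht])

lemma InteriorNonneg.reverse {c : List ℤ} (hc : InteriorNonneg c) :
    InteriorNonneg c.reverse := by
  intro p w s hp hs hpws
  have := hc s.reverse w.reverse p.reverse (by simpa) (by simpa)
    (by rw [← List.reverse_reverse c, hpws]; simp)
  simpa [etaProd_reverse] using this

lemma InteriorNonneg.expand {a b : ℤ} {t : List ℤ} (hc : InteriorNonneg (a :: b :: t)) :
    InteriorNonneg ((a + 1) :: 1 :: (b + 1) :: t) := by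
  intro p w s hp hs hpws
  match p, w with
  | [], _ => exact absurd rfl hp
  | _, [] => simp
  | [_], [x] =>
    simp only [List.cons_append, List.nil_append, List.cons.injEq] at hpws
    simp [etaProd_cons_zero_zero, ← hpws.2.1]
  | [_], x :: y :: w =>
    simp only [List.cons_append, List.nil_append, List.cons.injEq] at hpws
    obtain ⟨-, rfl, rfl, rfl⟩ := hpws
    have := hc [a] (b :: w) s (by simp) hs (by simp)
    simp only [etaProd_cons_zero_zero, etaProd_cons_one] at this ⊢
    linarith
  | [_, _], y :: w =>
    simp only [List.cons_append, List.nil_append, List.cons.injEq] at hpws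
    obtain ⟨-, -, rfl, rfl⟩ := hpws
    have h₁ := hc [a] (b :: w) s (by simp) hs (by simp)
    have h₂ := hc [a, b] w s (by simp) hs (by simp)
    simp only [etaProd_cons_zero_zero] at h₁ ⊢
    linarith
  | _ :: _ :: _ :: p, w =>
    simp only [List.cons_append, List.cons.injEq] at hpws
    exact hc (a :: b :: p) w s (by simp) hs (by simp [hpws.2.2.2])

lemma IsEta.interiorNonneg {c : List ℤ} (h : IsEta c) : InteriorNonneg c := by
  induction h with
  | base =>
    intro p w s hp hs h
    have hlen := congrArg List.length h
    simp only [List.length_append, List.length_cons, List.length_nil] at hlen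
    have := List.length_pos_iff.mpr hp
    have := List.length_pos_iff.mpr hs
    have hw : w = [] := List.length_eq_zero_iff.mp (by omega)
    simp [hw]
  | rotate h ih => exact ih.rotate h.etaProd_eq
  | reverse _ ih => exact ih.reverse
  | expand _ ih => exact ih.expand

lemma phi_of_lt {c : List ℤ} {i j : ℕ} (hij : i < j) :
    phi c i j = etaProd ((c.drop (i - 1)).take (j - i)) 1 0 := by
  simp [phi, hij, hij.ne, etaProd]

lemma phi_comm (c : List ℤ) (i j : ℕ) : phi c i j = phi c j i := by
  rcases lt_trichotomy i j with h | rfl | h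
  · simp [phi, h, h.ne, h.ne', h.not_gt]
  · rfl
  · simp [phi, h, h.ne, h.ne', h.not_gt]

lemma IsEta.phi_nonneg_of_lt {c : List ℤ} (h : IsEta c) {i j : ℕ} (hi : 1 ≤ i) (hij : i < j)
    (hj : j ≤ c.length) : 0 ≤ phi c i j := by
  rw [phi_of_lt hij]
  have hdrop : c.drop (i - 1) = (c)[i - 1]'(by omega) :: c.drop i := by
    rw [List.drop_eq_getElem_cons (by omega), Nat.sub_add_cancel hi]
  obtain ⟨k, rfl⟩ := Nat.exists_eq_add_of_lt hij
  rw [hdrop, show i + k + 1 - i = k + 1 by omega, List.take_succ_cons, etaProd_cons_one]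
  refine h.interiorNonneg (c.take i) _ (c.drop (i + k)) ?_ ?_ ?_
  · rw [← List.length_pos_iff, List.length_take]; omega
  · rw [← List.length_pos_iff, List.length_drop]; omega
  · rw [← List.drop_drop, List.append_assoc, List.take_append_drop, List.take_append_drop]

lemma IsEta.phi_nonneg {c : List ℤ} (h : IsEta c) {i j : ℕ} (hi : i ∈ Finset.Icc 1 c.length)
    (hj : j ∈ Finset.Icc 1 c.length) : 0 ≤ phi c i j := by
  rw [Finset.mem_Icc] at hi hj
  rcases lt_trichotomy i j with hij | rfl | hij
  · exact h.phi_nonneg_of_lt hi.1 hij hj.2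
  · simp [phi]
  · rw [phi_comm]; exact h.phi_nonneg_of_lt hj.1 hij hi.2

/-- The determinant of the first columns of the partial products of lengths `i - 1`, `j - 1`. -/
def colDet (c : List ℤ) (i j : ℕ) : ℤ :=
  etaProd (c.take (i - 1)) 0 0 * etaProd (c.take (j - 1)) 1 0
    - etaProd (c.take (i - 1)) 1 0 * etaProd (c.take (j - 1)) 0 0

lemma phi_eq_colDet {c : List ℤ} {i j : ℕ} (hi : 1 ≤ i) (hij : i < j) :
    phi c i j = colDet c i j := by
  have hdet := det_etaProd (c.take (i - 1))
  rw [Matrix.det_fin_two] at hdet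
  rw [phi_of_lt hij, colDet, show j - 1 = (i - 1) + (j - i) by omega, List.take_add,
    etaProd_append]
  simp only [Matrix.mul_apply, Fin.sum_univ_two]
  linear_combination -etaProd ((c.drop (i - 1)).take (j - i)) 1 0 * hdet

lemma phi_eq_or_eq_neg_colDet {c : List ℤ} {i j : ℕ} (hi : 1 ≤ i) (hj : 1 ≤ j) :
    phi c i j = colDet c i j ∨ phi c i j = -colDet c i j := by
  rcases lt_trichotomy i j with hij | rfl | hij
  · exact .inl (phi_eq_colDet hi hij)
  · left; simp only [phi, colDet, if_true]; ring
  · right; rw [phi_comm, phi_eq_colDet hj hij, colDet, colDet]; ring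

lemma colDet_isCoprime {c : List ℤ} (i : ℕ) {j l : ℕ}
    (h : colDet c j l = 1 ∨ colDet c j l = -1) :
    IsCoprime (colDet c i j) (colDet c i l) := by
  have hdet := det_etaProd (c.take (i - 1))
  rw [Matrix.det_fin_two] at hdet
  let f : ℕ → ℤ := fun k => etaProd (c.take (i - 1)) 1 1 * etaProd (c.take (k - 1)) 0 0
    - etaProd (c.take (i - 1)) 0 1 * etaProd (c.take (k - 1)) 1 0
  have key : f j * colDet c i l - f l * colDet c i j = colDet c j l := by
    simp only [f, colDet]
    linear_combination (etaProd (c.take (j - 1)) 0 0 * etaProd (c.take (l - 1)) 1 0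
      - etaProd (c.take (j - 1)) 1 0 * etaProd (c.take (l - 1)) 0 0) * hdet
  rcases h with h | h
  · exact ⟨-f l, f j, by linarith⟩
  · exact ⟨f l, -f j, by linarith⟩

theorem gcd_of_edge (c : List ℤ) (h : IsEta c) (hn : 3 ≤ c.length)
    (i j l : ℕ) (hi : i ∈ Finset.Icc 1 c.length) (hj : j ∈ Finset.Icc 1 c.length)
    (hl : l ∈ Finset.Icc 1 c.length)
    (hij : i ≠ j) (hil : i ≠ l) (hjl : j ≠ l)
    (hedge : phi c j l = 1) :
    Int.gcd (phi c i j) (phi c i l) = 1 ∧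
    (phi c i j = phi c i l → phi c i j = 1 ∧ phi c i l = 1) := by
  rw [and_iff_left_of_imp]
  · have hi' := (Finset.mem_Icc.mp hi).1
    have hj' := (Finset.mem_Icc.mp hj).1
    have hl' := (Finset.mem_Icc.mp hl).1
    have hcop : IsCoprime (colDet c i j) (colDet c i l) := by
      apply colDet_isCoprime
      rcases phi_eq_or_eq_neg_colDet (c := c) hj' hl' with h | h <;> omega
    rw [← Int.isCoprime_iff_gcd_eq_one]
    rcases phi_eq_or_eq_neg_colDet (c := c) hi' hj' with h₁ | h₁ <;>
      rcases phi_eq_or_eq_neg_colDet (c := c) hi' hl' with h₂ | h₂ <;>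
      rw [h₁, h₂] <;> simpa [IsCoprime.neg_left_iff, IsCoprime.neg_right_iff] using hcop
  · intro hgcd heq
    have hnn := h.phi_nonneg hi hl
    rw [heq, Int.gcd_self] at hgcd
    omega
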